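/- Let P(x) = x² + p_1 x + p_0 ∈ ℤ[x] with |p_0| ≥ 2, let ε ∈ [0,1), and set k = ⌊ε|p_0|⌋. Suppose either ε ∈ [0,1/2), or ε = 1/2 and |p_0| is odd. Then P is an ε-CNS polynomial if and only if either (p_0 ≥ 2 and -k-1 ≤ p_1 ≤ |p_0| - k), or (p_0 ≤ -3, ε ≥ 1/|p_0|, and k + 2 - |p_0| ≤ p_1 ≤ k - 1). -/

import Mathlib

open Polynomial

/-- `P` is an `ε`-CNS polynomial: every integer polynomial `a` is congruent modulo `P`
to a sum `∑ d_j x^j` whose digits `d_j` lie in `N_ε = [-ε|P(0)|, (1-ε)|P(0)|) ∩ ℤ`. -/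
def IsEpsCNS (ε : ℝ) (P : Polynomial ℤ) : Prop :=
  ∀ a : Polynomial ℤ, ∃ l : ℕ, 0 < l ∧ ∃ dig : ℕ → ℤ,
    (∀ j < l, -(ε * |(P.coeff 0 : ℝ)|) ≤ (dig j : ℝ) ∧
        (dig j : ℝ) < (1 - ε) * |(P.coeff 0 : ℝ)|) ∧
    P ∣ a - ∑ j ∈ Finset.range l, C (dig j) * X ^ j

/-- Backward division orbit of `(u,v)` reaches `0`. -/
inductive GoodSt (p0 p1 m k : ℤ) : ℤ → ℤ → Prop
  | zero : GoodSt p0 p1 m k 0 0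
  | step (u v w : ℤ) (h1 : k + 1 - m ≤ u + p1 * v + p0 * w) (h2 : u + p1 * v + p0 * w ≤ k)
      (h : GoodSt p0 p1 m k v w) : GoodSt p0 p1 m k u v

lemma goodSt_inv {p0 p1 m k : ℤ} (I : ℤ → ℤ → Prop) (h0 : ¬ I 0 0)
    (hs : ∀ u v w, I u v → k + 1 - m ≤ u + p1 * v + p0 * w → u + p1 * v + p0 * w ≤ k → I v w)
    {u v : ℤ} (h : GoodSt p0 p1 m k u v) : ¬ I u v := by
  induction h with
  | zero => exact h0
  | step u v w h1 h2 _ ih => exact fun hI => ih (hs u v w hI h1 h2)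

lemma exists_quot {p0 m : ℤ} (k : ℤ) (hm : m = |p0|) (hm2 : 2 ≤ m) (e : ℤ) :
    ∃ w, k + 1 - m ≤ e + p0 * w ∧ e + p0 * w ≤ k := by
  have h0 : p0 ≠ 0 := by rintro rfl; simp at hm; omega
  have a1 := Int.emod_nonneg (e - (k + 1 - m)) h0
  have a2 := Int.emod_lt_abs (e - (k + 1 - m)) h0
  have a3 := Int.emod_add_mul_ediv (e - (k + 1 - m)) p0
  refine ⟨-((e - (k + 1 - m)) / p0), ?_, ?_⟩
  · rw [mul_neg]; linarith
  · rw [mul_neg]; linarith [Int.add_one_le_iff.mpr a2]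

lemma goodSt_add {p0 p1 m k : ℤ} (hm : m = |p0|) (hm2 : 2 ≤ m) (E : ℤ → ℤ → Prop)
    (hE : ∀ s t w, E s t → -m < s + p1 * t + p0 * w → s + p1 * t + p0 * w < m → E t w)
    (hG : ∀ s t, E s t → GoodSt p0 p1 m k s t)
    {u v : ℤ} (h : GoodSt p0 p1 m k u v) :
    ∀ s t, E s t → GoodSt p0 p1 m k (u + s) (v + t) := by
  induction h with
  | zero => intro s t h; simpa using hG s t h
  | step u v w h1 h2 _ ih =>
    intro s t h
    obtain ⟨w', a, b⟩ := exists_quot k hm hm2 (u + p1 * v + p0 * w + (s + p1 * t))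
    refine GoodSt.step _ _ (w + w') (by linarith) (by linarith) (ih _ _ (hE s t w' h ?_ ?_))
    · linarith
    · linarith

lemma goodSt_all {p0 p1 m k : ℤ} (hm : m = |p0|) (hm2 : 2 ≤ m) (E : ℤ → ℤ → Prop)
    (hE : ∀ s t w, E s t → -m < s + p1 * t + p0 * w → s + p1 * t + p0 * w < m → E t w)
    (hG : ∀ s t, E s t → GoodSt p0 p1 m k s t)
    (e1 : E 1 0) (e2 : E (-1) 0) (e3 : E 0 1) (e4 : E 0 (-1)) (u v : ℤ) :
    GoodSt p0 p1 m k u v := by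
  have A : ∀ u, GoodSt p0 p1 m k u 0 := by
    intro u
    induction u using Int.induction_on with
    | zero => exact .zero
    | succ i ih => simpa using goodSt_add hm hm2 E hE hG ih 1 0 e1
    | pred i ih => simpa [sub_eq_add_neg] using goodSt_add hm hm2 E hE hG ih (-1) 0 e2
  induction v using Int.induction_on with
  | zero => exact A u
  | succ i ih => simpa using goodSt_add hm hm2 E hE hG ih 0 1 e3
  | pred i ih => simpa [sub_eq_add_neg] using goodSt_add hm hm2 E hE hG ih 0 (-1) e4

/-- the linear polynomial of a state -/
noncomputable def stPoly (p1 u v : ℤ) : Polynomial ℤ := C (-u - p1 * v) + C (-v) * X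

lemma stPoly_step (p0 p1 u v w : ℤ) :
    stPoly p1 u v = C (-(u + p1 * v + p0 * w)) + X * stPoly p1 v w
      + C w * (X ^ 2 + C p1 * X + C p0) := by
  simp only [stPoly, map_sub, map_add, map_mul, map_neg]
  ring

/-- representability with integer digit bounds -/
def IntRep (P : Polynomial ℤ) (m k : ℤ) (l : ℕ) (a : Polynomial ℤ) : Prop :=
  ∃ dig : ℕ → ℤ, (∀ j < l, -k ≤ dig j ∧ dig j ≤ m - 1 - k) ∧
    P ∣ a - ∑ j ∈ Finset.range l, C (dig j) * X ^ j

lemma sum_shift (dig : ℕ → ℤ) (l : ℕ) :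
    ∑ j ∈ Finset.range (l + 1), C (dig j) * (X : Polynomial ℤ) ^ j
      = C (dig 0) + X * ∑ j ∈ Finset.range l, C (dig (j + 1)) * X ^ j := by
  rw [Finset.sum_range_succ', Finset.mul_sum, add_comm]
  congr 1
  · simp
  · apply Finset.sum_congr rfl; intros; ring

lemma intRep_of_good {p0 p1 m k : ℤ} (hk0 : 0 ≤ k) (hkm : k ≤ m - 1)
    {u v : ℤ} (h : GoodSt p0 p1 m k u v) :
    ∃ l, 0 < l ∧ IntRep (X ^ 2 + C p1 * X + C p0) m k l (stPoly p1 u v) := by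
  induction h with
  | zero =>
    refine ⟨1, one_pos, fun _ => 0, ?_, ?_⟩
    · intro j _; constructor <;> simp <;> omega
    · simp [stPoly]
  | step u v w h1 h2 _ ih =>
    obtain ⟨l, hl, dig, hd, q, hq⟩ := ih
    refine ⟨l + 1, by omega, fun j => if j = 0 then -(u + p1 * v + p0 * w) else dig (j - 1),
      ?_, ?_⟩
    · intro j hj
      by_cases h : j = 0
      · simp only [h, if_true]; constructor <;> linarith
      · simp only [h, if_false]; exact hd _ (by omega)
    · rw [sum_shift, stPoly_step p0 p1 u v w]
      simp only [if_true, Nat.succ_ne_zero, if_false, Nat.add_sub_cancel]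
      refine ⟨X * q + C w, ?_⟩
      linear_combination X * hq

lemma good_of_intRep {p0 p1 m k : ℤ} (h0 : p0 ≠ 0) (l : ℕ) :
    ∀ u v, IntRep (X ^ 2 + C p1 * X + C p0) m k l (stPoly p1 u v) → GoodSt p0 p1 m k u v := by
  have hmonic : (X ^ 2 + C p1 * X + C p0 : Polynomial ℤ).Monic := by monicity!
  have hdeg : (X ^ 2 + C p1 * X + C p0 : Polynomial ℤ).natDegree = 2 := by compute_degree!
  induction l with
  | zero =>
    rintro u v ⟨dig, -, hd⟩
    simp only [Finset.range_zero, Finset.sum_empty, sub_zero] at hd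
    have hz : stPoly p1 u v = 0 := by
      apply eq_zero_of_dvd_of_natDegree_lt hd
      rw [hdeg]
      have : (stPoly p1 u v).natDegree ≤ 1 := by unfold stPoly; compute_degree
      omega
    have c1 := congrArg (fun p => coeff p 1) hz
    have c0 := congrArg (fun p => coeff p 0) hz
    simp only [stPoly, coeff_add, coeff_C_mul, coeff_C, coeff_X, coeff_zero] at c1 c0
    have hv : v = 0 := by simpa using c1
    subst hv
    simp at c0
    subst c0
    exact .zero
  | succ l ih =>
    rintro u v ⟨dig, hd, q, hq⟩
    rw [sum_shift] at hq
    have c0 := congrArg (fun p => coeff p 0) hq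
    simp [stPoly, mul_coeff_zero] at c0
    set w := q.coeff 0 with hw
    have hd0 := hd 0 (by omega)
    have e0 : dig 0 = -(u + p1 * v + p0 * w) := by linarith
    refine GoodSt.step u v w (by linarith) (by linarith) (ih v w ⟨fun j => dig (j + 1),
      fun j hj => hd _ (by omega), ?_⟩)
    rw [stPoly_step p0 p1 u v w, e0] at hq
    have hqX := divX_mul_X_add q
    rw [← hw] at hqX
    refine ⟨q.divX, ?_⟩
    apply mul_left_cancel₀ (X_ne_zero : (X : Polynomial ℤ) ≠ 0)
    linear_combination hq - (X ^ 2 + C p1 * X + C p0) * hqX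

lemma cns_iff (p0 p1 : ℤ) (hp : 2 ≤ |p0|) (ε : ℝ) (hε0 : 0 ≤ ε) (hε1 : ε < 1)
    (k : ℤ) (hk : k = ⌊ε * (|p0| : ℝ)⌋) :
    IsEpsCNS ε (X ^ 2 + C p1 * X + C p0) ↔ ∀ u v, GoodSt p0 p1 |p0| k u v := by
  have hpR : (2 : ℝ) ≤ |(p0 : ℝ)| := by exact_mod_cast hp
  have h0 : p0 ≠ 0 := by rintro rfl; simp at hp
  have hk0 : 0 ≤ k := by rw [hk]; apply Int.floor_nonneg.mpr; positivity
  have hkm : k ≤ |p0| - 1 := by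
    have : k < |p0| := by
      rw [hk, Int.floor_lt]; push_cast; nlinarith
    omega
  have hc : (X ^ 2 + C p1 * X + C p0 : Polynomial ℤ).coeff 0 = p0 := by simp
  have hb : ∀ d : ℤ, (-(ε * |(p0 : ℝ)|) ≤ (d : ℝ) ∧ (d : ℝ) < (1 - ε) * |(p0 : ℝ)|) ↔
      (-k ≤ d ∧ d ≤ |p0| - 1 - k) := by
    intro d
    have a1 : -d ≤ k ↔ ((-d : ℤ) : ℝ) ≤ ε * |(p0 : ℝ)| := by rw [hk, Int.le_floor]
    have a2 : k < |p0| - d ↔ ε * |(p0 : ℝ)| < ((|p0| - d : ℤ) : ℝ) := by rw [hk, Int.floor_lt]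
    push_cast at a1 a2
    constructor
    · rintro ⟨x, y⟩
      have := a1.mpr (by linarith)
      have := a2.mpr (by linarith)
      omega
    · rintro ⟨x, y⟩
      have := a1.mp (by linarith)
      have := a2.mp (by linarith)
      constructor <;> linarith
  have hmonic : (X ^ 2 + C p1 * X + C p0 : Polynomial ℤ).Monic := by monicity!
  have hdeg : (X ^ 2 + C p1 * X + C p0 : Polynomial ℤ).natDegree = 2 := by compute_degree!
  unfold IsEpsCNS
  simp only [hc, hb]
  constructor
  · intro h u v
    obtain ⟨l, -, dig, h1, h2⟩ := h (stPoly p1 u v)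
    exact good_of_intRep h0 l u v ⟨dig, h1, h2⟩
  · intro h a
    set P := (X ^ 2 + C p1 * X + C p0 : Polynomial ℤ) with hP
    have hr : (a %ₘ P).natDegree ≤ 1 := by
      have := natDegree_modByMonic_lt a hmonic (by intro h; simp [h] at hdeg)
      omega
    have hdm := modByMonic_add_div a P
    have hlin := eq_X_add_C_of_natDegree_le_one hr
    set r1 := (a %ₘ P).coeff 1
    set r0 := (a %ₘ P).coeff 0
    obtain ⟨l, hl, dig, h1, q, h2⟩ := intRep_of_good hk0 hkm (h (-r0 + p1 * r1) (-r1))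
    refine ⟨l, hl, dig, h1, q + a /ₘ P, ?_⟩
    have : stPoly p1 (-r0 + p1 * r1) (-r1) = a %ₘ P := by
      rw [hlin]; simp only [stPoly, map_sub, map_add, map_mul, map_neg]; ring
    rw [this] at h2
    linear_combination h2 - hdm

lemma suff_pos {p1 m k : ℤ} (hm2 : 2 ≤ m) (hk0 : 0 ≤ k) (hkm : 2 * k + 1 ≤ m)
    (h1 : -k - 1 ≤ p1) (h2 : p1 ≤ m - k) (u v : ℤ) : GoodSt m p1 m k u v := by
  have hm : m = |m| := (abs_of_nonneg (by omega)).symm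
  have g00 : GoodSt m p1 m k 0 0 := .zero
  have gm0 : GoodSt m p1 m k (-1) 0 := .step _ _ 0 (by omega) (by omega) g00
  have range : ∀ e w : ℤ, -m < e + m * w → e + m * w < m → -m ≤ e → e ≤ m →
      w = 0 ∨ (w = 1 ∧ e < 0) ∨ (w = -1 ∧ 0 < e) := by
    intro e w a b c d
    have w1 : w < 2 := by nlinarith
    have w2 : -2 < w := by nlinarith
    have : w = -1 ∨ w = 0 ∨ w = 1 := by omega
    rcases this with rfl | rfl | rfl <;> omega
  rcases lt_trichotomy p1 0 with hp | hp | hp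
  · have gm1 : GoodSt m p1 m k 0 (-1) := by
      by_cases h : -p1 ≤ k
      · exact .step _ _ 0 (by omega) (by omega) gm0
      · refine .step _ _ (-1) (by omega) (by omega) (.step _ _ 0 (by omega) (by omega) gm0)
    have g10 : GoodSt m p1 m k 1 0 := by
      by_cases h : 1 ≤ k
      · exact .step _ _ 0 (by omega) (by omega) g00
      · exact .step _ _ (-1) (by omega) (by omega) gm1
    have g11 : GoodSt m p1 m k 1 1 := .step _ _ 0 (by omega) (by omega) g10
    have g01 : GoodSt m p1 m k 0 1 := by
      by_cases h : k + 1 - m ≤ p1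
      · exact .step _ _ 0 (by omega) (by omega) g10
      · exact .step _ _ 1 (by omega) (by omega) g11
    have gmm : GoodSt m p1 m k (-1) (-1) := .step _ _ 0 (by omega) (by omega) gm0
    refine goodSt_all hm hm2 (fun s t => (s = 0 ∧ t = 0) ∨ (s = 1 ∧ t = 0) ∨ (s = -1 ∧ t = 0) ∨
      (s = 0 ∧ t = 1) ∨ (s = 0 ∧ t = -1) ∨ (s = 1 ∧ t = 1) ∨ (s = -1 ∧ t = -1))
      ?_ ?_ (by simp) (by simp) (by simp) (by simp) u v
    · rintro s t w (⟨rfl, rfl⟩ | ⟨rfl, rfl⟩ | ⟨rfl, rfl⟩ | ⟨rfl, rfl⟩ | ⟨rfl, rfl⟩ |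
        ⟨rfl, rfl⟩ | ⟨rfl, rfl⟩) a b <;>
      · have := range _ w a b (by omega) (by omega)
        omega
    · rintro s t (⟨rfl, rfl⟩ | ⟨rfl, rfl⟩ | ⟨rfl, rfl⟩ | ⟨rfl, rfl⟩ | ⟨rfl, rfl⟩ |
        ⟨rfl, rfl⟩ | ⟨rfl, rfl⟩) <;> assumption
  · subst hp
    have gm1 : GoodSt m 0 m k 0 (-1) := .step _ _ 0 (by omega) (by omega) gm0
    have g10 : GoodSt m 0 m k 1 0 := by
      by_cases h : 1 ≤ k
      · exact .step _ _ 0 (by omega) (by omega) g00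
      · exact .step _ _ (-1) (by omega) (by omega) gm1
    have g01 : GoodSt m 0 m k 0 1 := .step _ _ 0 (by omega) (by omega) g10
    have gm1' : GoodSt m 0 m k (-1) 1 := .step _ _ 0 (by omega) (by omega) g10
    have gmm : GoodSt m 0 m k (-1) (-1) := .step _ _ 0 (by omega) (by omega) gm0
    have g1m : GoodSt m 0 m k 1 (-1) := by
      by_cases h : 1 ≤ k
      · exact .step _ _ 0 (by omega) (by omega) gm0
      · exact .step _ _ (-1) (by omega) (by omega) gmm
    have g11 : GoodSt m 0 m k 1 1 := by
      by_cases h : 1 ≤ k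
      · exact .step _ _ 0 (by omega) (by omega) g10
      · exact .step _ _ (-1) (by omega) (by omega) g1m
    refine goodSt_all hm hm2 (fun s t => (s = 0 ∨ s = 1 ∨ s = -1) ∧ (t = 0 ∨ t = 1 ∨ t = -1))
      ?_ ?_ (by simp) (by simp) (by simp) (by simp) u v
    · rintro s t w ⟨rfl | rfl | rfl, rfl | rfl | rfl⟩ a b <;>
      · have := range _ w a b (by omega) (by omega)
        omega
    · rintro s t ⟨rfl | rfl | rfl, rfl | rfl | rfl⟩ <;> assumption
  · have g1m : GoodSt m p1 m k 1 (-1) := .step _ _ 0 (by omega) (by omega) gm0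
    have gm1' : GoodSt m p1 m k (-1) 1 ∧ GoodSt m p1 m k 0 (-1) ∧ GoodSt m p1 m k 1 0 := by
      by_cases h : 1 ≤ k
      · have g10 : GoodSt m p1 m k 1 0 := .step _ _ 0 (by omega) (by omega) g00
        have A : GoodSt m p1 m k (-1) 1 := by
          by_cases h : p1 - 1 ≤ k
          · exact .step _ _ 0 (by omega) (by omega) g10
          · exact .step _ _ (-1) (by omega) (by omega) g1m
        refine ⟨A, ?_, g10⟩
        by_cases h : p1 ≤ m - k - 1
        · exact .step _ _ 0 (by omega) (by omega) gm0
        · exact .step _ _ 1 (by omega) (by omega) A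
      · have B : GoodSt m p1 m k 0 (-1) := by
          by_cases h : p1 ≤ m - k - 1
          · exact .step _ _ 0 (by omega) (by omega) gm0
          · exact .step _ _ 1 (by omega) (by omega) (.step _ _ (-1) (by omega) (by omega) g1m)
        have g10 : GoodSt m p1 m k 1 0 := .step _ _ (-1) (by omega) (by omega) B
        refine ⟨?_, B, g10⟩
        by_cases h : p1 - 1 ≤ k
        · exact .step _ _ 0 (by omega) (by omega) g10
        · exact .step _ _ (-1) (by omega) (by omega) g1m
    obtain ⟨gm1', gm1, g10⟩ := gm1'
    have g01 : GoodSt m p1 m k 0 1 := by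
      by_cases h : p1 ≤ k
      · exact .step _ _ 0 (by omega) (by omega) g10
      · exact .step _ _ (-1) (by omega) (by omega) g1m
    refine goodSt_all hm hm2 (fun s t => (s = 0 ∧ t = 0) ∨ (s = 1 ∧ t = 0) ∨ (s = -1 ∧ t = 0) ∨
      (s = 0 ∧ t = 1) ∨ (s = 0 ∧ t = -1) ∨ (s = 1 ∧ t = -1) ∨ (s = -1 ∧ t = 1))
      ?_ ?_ (by simp) (by simp) (by simp) (by simp) u v
    · rintro s t w (⟨rfl, rfl⟩ | ⟨rfl, rfl⟩ | ⟨rfl, rfl⟩ | ⟨rfl, rfl⟩ | ⟨rfl, rfl⟩ |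
        ⟨rfl, rfl⟩ | ⟨rfl, rfl⟩) a b <;>
      · have := range _ w a b (by omega) (by omega)
        omega
    · rintro s t (⟨rfl, rfl⟩ | ⟨rfl, rfl⟩ | ⟨rfl, rfl⟩ | ⟨rfl, rfl⟩ | ⟨rfl, rfl⟩ |
        ⟨rfl, rfl⟩ | ⟨rfl, rfl⟩) <;> assumption

lemma suff_neg {p1 m k : ℤ} (hk0 : 1 ≤ k) (hkm : 2 * k + 1 ≤ m)
    (h1 : k + 2 - m ≤ p1) (h2 : p1 ≤ k - 1) (u v : ℤ) : GoodSt (-m) p1 m k u v := by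
  have hm2 : 2 ≤ m := by omega
  have hm : m = |(-m)| := by rw [abs_neg]; exact (abs_of_nonneg (by omega)).symm
  have g00 : GoodSt (-m) p1 m k 0 0 := .zero
  have gm0 : GoodSt (-m) p1 m k (-1) 0 := .step _ _ 0 (by omega) (by omega) g00
  have g10 : GoodSt (-m) p1 m k 1 0 := .step _ _ 0 (by omega) (by omega) g00
  have g01 : GoodSt (-m) p1 m k 0 1 := .step _ _ 0 (by omega) (by omega) g10
  have gm1' : GoodSt (-m) p1 m k (-1) 1 := .step _ _ 0 (by omega) (by omega) g10
  have gm1 : GoodSt (-m) p1 m k 0 (-1) := by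
    by_cases h : -p1 ≤ k
    · exact .step _ _ 0 (by omega) (by omega) gm0
    · exact .step _ _ 1 (by omega) (by omega) gm1'
  have range : ∀ e w : ℤ, -m < e + (-m) * w → e + (-m) * w < m → -m ≤ e → e ≤ m →
      w = 0 ∨ (w = 1 ∧ 0 < e) ∨ (w = -1 ∧ e < 0) := by
    intro e w a b c d
    have w1 : w < 2 := by nlinarith
    have w2 : -2 < w := by nlinarith
    have : w = -1 ∨ w = 0 ∨ w = 1 := by omega
    rcases this with rfl | rfl | rfl <;> omega
  rcases le_or_gt 0 p1 with hp | hp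
  · have g11 : GoodSt (-m) p1 m k 1 1 := .step _ _ 0 (by omega) (by omega) g10
    have gmm : GoodSt (-m) p1 m k (-1) (-1) := .step _ _ 0 (by omega) (by omega) gm0
    refine goodSt_all hm hm2 (fun s t => (s = 0 ∧ t = 0) ∨ (s = 1 ∧ t = 0) ∨ (s = -1 ∧ t = 0) ∨
      (s = 0 ∧ t = 1) ∨ (s = 0 ∧ t = -1) ∨ (s = 1 ∧ t = 1) ∨ (s = -1 ∧ t = -1))
      ?_ ?_ (by simp) (by simp) (by simp) (by simp) u v
    · rintro s t w (⟨rfl, rfl⟩ | ⟨rfl, rfl⟩ | ⟨rfl, rfl⟩ | ⟨rfl, rfl⟩ | ⟨rfl, rfl⟩ |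
        ⟨rfl, rfl⟩ | ⟨rfl, rfl⟩) a b <;>
      · have := range _ w a b (by omega) (by omega)
        omega
    · rintro s t (⟨rfl, rfl⟩ | ⟨rfl, rfl⟩ | ⟨rfl, rfl⟩ | ⟨rfl, rfl⟩ | ⟨rfl, rfl⟩ |
        ⟨rfl, rfl⟩ | ⟨rfl, rfl⟩) <;> assumption
  · have g1m : GoodSt (-m) p1 m k 1 (-1) := by
      by_cases h : 1 - p1 ≤ k
      · exact .step _ _ 0 (by omega) (by omega) gm0
      · exact .step _ _ 1 (by omega) (by omega) gm1'
    refine goodSt_all hm hm2 (fun s t => (s = 0 ∧ t = 0) ∨ (s = 1 ∧ t = 0) ∨ (s = -1 ∧ t = 0) ∨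
      (s = 0 ∧ t = 1) ∨ (s = 0 ∧ t = -1) ∨ (s = 1 ∧ t = -1) ∨ (s = -1 ∧ t = 1))
      ?_ ?_ (by simp) (by simp) (by simp) (by simp) u v
    · rintro s t w (⟨rfl, rfl⟩ | ⟨rfl, rfl⟩ | ⟨rfl, rfl⟩ | ⟨rfl, rfl⟩ | ⟨rfl, rfl⟩ |
        ⟨rfl, rfl⟩ | ⟨rfl, rfl⟩) a b <;>
      · have := range _ w a b (by omega) (by omega)
        omega
    · rintro s t (⟨rfl, rfl⟩ | ⟨rfl, rfl⟩ | ⟨rfl, rfl⟩ | ⟨rfl, rfl⟩ | ⟨rfl, rfl⟩ |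
        ⟨rfl, rfl⟩ | ⟨rfl, rfl⟩) <;> assumption

lemma nec_pos {p1 m k : ℤ} (hm2 : 2 ≤ m) (hk0 : 0 ≤ k) (hkm : 2 * k + 1 ≤ m)
    (h : ∀ u v, GoodSt m p1 m k u v) : -k - 1 ≤ p1 ∧ p1 ≤ m - k := by
  constructor
  · by_contra! hc
    by_cases h1 : -k ≤ 1 + p1 + m
    · refine goodSt_inv (fun u v => u = -1 ∧ v = -1) (by simp) ?_ (h (-1) (-1)) ⟨rfl, rfl⟩
      rintro u v w ⟨rfl, rfl⟩ a b
      refine ⟨rfl, ?_⟩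
      have : w < 0 := by nlinarith
      have : -2 < w := by nlinarith
      omega
    · refine goodSt_inv (fun u v => 1 ≤ v ∧ u ≤ v) (by simp) ?_ (h 1 1) (by simp)
      rintro u v w ⟨hv, hu⟩ a b
      have : v - 1 < w := by
        by_contra! hw
        have := mul_nonneg (show 0 ≤ -m - k - 2 - p1 by omega) (show 0 ≤ v by omega)
        have := mul_le_mul_of_nonneg_left hw (show 0 ≤ m by omega)
        have := mul_nonneg hk0 (show 0 ≤ v by omega)
        nlinarith
      omega
  · by_contra! hc
    by_cases h1 : p1 ≤ m + k + 1
    · refine goodSt_inv (fun u v => (u = 1 ∧ v = -1) ∨ (u = -1 ∧ v = 1)) (by simp) ?_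
        (h 1 (-1)) (by simp)
      rintro u v w (⟨rfl, rfl⟩ | ⟨rfl, rfl⟩) a b
      · have : w < 2 := by nlinarith
        have : 0 < w := by nlinarith
        omega
      · have : w < 0 := by nlinarith
        have : -2 < w := by nlinarith
        omega
    · refine goodSt_inv (fun u v => (1 ≤ v ∧ -u ≤ v) ∨ (v ≤ -1 ∧ v ≤ -u)) (by simp) ?_
        (h 1 1) (by simp)
      rintro u v w (⟨hv, hu⟩ | ⟨hv, hu⟩) a b
      · have : v - 1 < -w := by
          by_contra! hw
          have := mul_nonneg (show 0 ≤ p1 - m - k - 2 by omega) (show 0 ≤ v by omega)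
          have := mul_le_mul_of_nonneg_left hw (show 0 ≤ m by omega)
          have := mul_nonneg hk0 (show 0 ≤ v by omega)
          nlinarith
        omega
      · have : -v - 1 < w := by
          by_contra! hw
          have := mul_nonneg (show 0 ≤ p1 - m - k - 2 by omega) (show 0 ≤ -v by omega)
          have := mul_le_mul_of_nonneg_left hw (show 0 ≤ m by omega)
          have := mul_nonneg hk0 (show 0 ≤ -v by omega)
          nlinarith
        omega

lemma nec_neg {p1 m k : ℤ} (hm2 : 2 ≤ m) (hk0 : 0 ≤ k) (hkm : 2 * k + 1 ≤ m)
    (h : ∀ u v, GoodSt (-m) p1 m k u v) : 1 ≤ k ∧ k + 2 - m ≤ p1 ∧ p1 ≤ k - 1 := by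
  have hk1 : 1 ≤ k := by
    by_contra! hc
    have hk : k = 0 := by omega
    subst hk
    have hmR : (2 : ℝ) ≤ m := by exact_mod_cast hm2
    have hdisc : (0 : ℝ) ≤ (p1 : ℝ) ^ 2 + 4 * m := by positivity
    obtain ⟨α, hα, hroot⟩ : ∃ α : ℝ, 0 < α ∧ α ^ 2 + p1 * α = m := by
      refine ⟨(-p1 + √((p1 : ℝ) ^ 2 + 4 * m)) / 2, ?_, ?_⟩
      · have : (p1 : ℝ) < √((p1 : ℝ) ^ 2 + 4 * m) := Real.lt_sqrt_of_sq_lt (by linarith)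
        linarith
      · nlinarith [Real.sq_sqrt hdisc]
    refine goodSt_inv (fun u v => 0 < (u : ℝ) + (p1 + α) * v) (by simp) ?_ (h 1 0) (by simp)
    intro u v w hI a b
    have b' : (u : ℝ) + p1 * v + -m * w ≤ 0 := by exact_mod_cast b
    have : 0 < α * ((v : ℝ) + (p1 + α) * w) := by
      have : α * ((v : ℝ) + (p1 + α) * w) = α * v + m * w := by rw [← hroot]; ring
      rw [this]; linarith
    exact pos_of_mul_pos_right this hα.le
  refine ⟨hk1, ?_, ?_⟩
  · by_contra! hc
    by_cases h1 : 1 - m - k ≤ p1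
    · refine goodSt_inv (fun u v => (u = 1 ∧ v = -1) ∨ (u = -1 ∧ v = 1)) (by simp) ?_
        (h 1 (-1)) (by simp)
      rintro u v w (⟨rfl, rfl⟩ | ⟨rfl, rfl⟩) a b
      · have : w < 2 := by nlinarith
        have : 0 < w := by nlinarith
        omega
      · have : w < 0 := by nlinarith
        have : -2 < w := by nlinarith
        omega
    · refine goodSt_inv (fun u v => (1 ≤ v ∧ u ≤ -1) ∨ (v ≤ -1 ∧ 1 ≤ u)) (by simp) ?_
        (h 1 (-1)) (by simp)
      rintro u v w (⟨hv, hu⟩ | ⟨hv, hu⟩) a b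
      · have : v - 1 < -w := by
          by_contra! hw
          have := mul_nonneg (show 0 ≤ -p1 - m - k by omega) (show 0 ≤ v by omega)
          have := mul_le_mul_of_nonneg_left hw (show 0 ≤ m by omega)
          have := mul_nonneg hk0 (show 0 ≤ v by omega)
          nlinarith
        omega
      · have : -v - 1 < w := by
          by_contra! hw
          have := mul_nonneg (show 0 ≤ -p1 - m - k by omega) (show 0 ≤ -v by omega)
          have := mul_le_mul_of_nonneg_left hw (show 0 ≤ m by omega)
          have := mul_nonneg hk0 (show 0 ≤ -v by omega)
          nlinarith
        omega
  · by_contra! hc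
    by_cases h1 : p1 ≤ m + k - 1
    · refine goodSt_inv (fun u v => u = 1 ∧ v = 1) (by simp) ?_ (h 1 1) ⟨rfl, rfl⟩
      rintro u v w ⟨rfl, rfl⟩ a b
      refine ⟨rfl, ?_⟩
      have : 0 < w := by nlinarith
      have : w < 2 := by nlinarith
      omega
    · refine goodSt_inv (fun u v => 1 ≤ v ∧ 1 ≤ u) (by simp) ?_ (h 1 1) (by simp)
      rintro u v w ⟨hv, hu⟩ a b
      have : v - 1 < w := by
        by_contra! hw
        have := mul_nonneg (show 0 ≤ p1 - m - k by omega) (show 0 ≤ v by omega)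
        have := mul_le_mul_of_nonneg_left hw (show 0 ≤ m by omega)
        have := mul_le_mul_of_nonneg_left hv hk0
        nlinarith
      omega

theorem stmt_3 (p0 p1 : ℤ) (hp : 2 ≤ |p0|) (ε : ℝ) (hε0 : 0 ≤ ε) (hε1 : ε < 1)
    (hcase : ε < 1/2 ∨ (ε = 1/2 ∧ Odd |p0|))
    (k : ℤ) (hk : k = ⌊ε * (|p0| : ℝ)⌋) :
    IsEpsCNS ε (X ^ 2 + C p1 * X + C p0) ↔
      (2 ≤ p0 ∧ -k - 1 ≤ p1 ∧ p1 ≤ |p0| - k) ∨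
      (p0 ≤ -3 ∧ 1 / (|p0| : ℝ) ≤ ε ∧ k + 2 - |p0| ≤ p1 ∧ p1 ≤ k - 1) := by
  rw [cns_iff p0 p1 hp ε hε0 hε1 k hk]
  have hpR : (2 : ℝ) ≤ |(p0 : ℝ)| := by exact_mod_cast hp
  have hk0 : 0 ≤ k := by rw [hk]; apply Int.floor_nonneg.mpr; positivity
  have hkm : 2 * k + 1 ≤ |p0| := by
    have hfl : (k : ℝ) ≤ ε * |(p0 : ℝ)| := by rw [hk]; exact Int.floor_le _
    rcases hcase with h | ⟨h, ho⟩
    · have : (2 * k : ℝ) < |(p0 : ℝ)| := by nlinarith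
      have : 2 * k < |p0| := by exact_mod_cast this
      omega
    · have : (2 * k : ℝ) ≤ |(p0 : ℝ)| := by rw [h] at hfl; linarith
      have : 2 * k ≤ |p0| := by exact_mod_cast this
      obtain ⟨r, hr⟩ := ho
      omega
  have hε : 1 / |(p0 : ℝ)| ≤ ε ↔ 1 ≤ k := by
    rw [hk, Int.le_floor, div_le_iff₀ (by linarith)]
    simp
  rw [hε]
  rcases le_or_gt 0 p0 with h | h
  · rw [abs_of_nonneg h] at *
    constructor
    · intro hg
      exact Or.inl ⟨hp, nec_pos hp hk0 hkm hg⟩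
    · rintro (⟨_, a, b⟩ | ⟨a, _⟩)
      · exact suff_pos hp hk0 hkm a b
      · omega
  · obtain ⟨m, rfl⟩ : ∃ m, p0 = -m := ⟨-p0, by ring⟩
    rw [abs_of_neg h, neg_neg] at *
    constructor
    · intro hg
      obtain ⟨a, b, c⟩ := nec_neg hp hk0 hkm hg
      exact Or.inr ⟨by omega, a, b, c⟩
    · rintro (⟨a, _⟩ | ⟨_, a, b, c⟩)
      · omega
      · exact suff_neg a hkm b c
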